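/- Let $G$ be a function with property $\mathcal{P}$ and let $\|\cdot\|_G$ be the Orlicz norm induced by $G$. There exist constants $C\ge 1$ and $\alpha_G\ge 1$ depending only on $G$ such that the following holds for every $n\ge 2$, $m\ge 1$, and every matrix $A\in\mathbb{R}^{n\times m}$ of rank $d\le n$: let $D\in\mathbb{R}^{n\times n}$ be a random diagonal matrix whose diagonal entries are nonnegative random variables each with marginal cumulative distribution function $t\mapsto 1-e^{-G(t)}$ on $[0,\infty)$. Then with probability at least $0.99$, for all $x\in\mathbb{R}^m$ simultaneously, $\|D^{-1}Ax\|_G\le C\,\alpha_G\,d^2\log(n)\,\|Ax\|_G$. -/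

import Mathlib

open MeasureTheory ProbabilityTheory Real Filter
open scoped ENNReal NNReal

noncomputable section

/-- The Orlicz norm on `ℝⁿ` induced by a function `G`. -/
def OrliczNorm (G : ℝ → ℝ) {n : ℕ} (x : Fin n → ℝ) : ℝ :=
  sInf {α : ℝ | 0 < α ∧ ∑ i, G (|x i| / α) ≤ 1}

/-- The `ℓ₁` norm of a vector. -/
def l1Norm {n : ℕ} (x : Fin n → ℝ) : ℝ := ∑ i, |x i|

/-- The `ℓ₂` norm of a vector. -/
def l2Norm {n : ℕ} (x : Fin n → ℝ) : ℝ := Real.sqrt (∑ i, (x i) ^ 2)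

/-- The `ℓ∞` norm of a vector. -/
def linfNorm {n : ℕ} (x : Fin n → ℝ) : ℝ := ⨆ i, |x i|

/-- Property 𝒫 from the paper, with growth constant `CG` (condition (5)). -/
structure PropertyP (G : ℝ → ℝ) (CG : ℝ) : Prop where
  nonneg : ∀ x, 0 ≤ G x
  nonzero : ∃ x, 0 ≤ x ∧ G x ≠ 0
  mono : MonotoneOn G (Set.Ici 0)
  convex : ConvexOn ℝ (Set.Ici 0) G
  zero : G 0 = 0
  one : G 1 = 1
  even : ∀ x, G x = G (-x)
  linear : ∃ s > (0:ℝ), ∀ x > (1:ℝ), G x = s * x + (1 - s)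
  smooth : ∃ δG > (0:ℝ), (∀ x ∈ Set.Ioo (0:ℝ) δG, DifferentiableAt ℝ G x ∧
      DifferentiableAt ℝ (deriv G) x) ∧
    ∃ c₁ c₂ : ℝ, HasDerivWithinAt G c₁ (Set.Ici 0) 0 ∧
      Filter.Tendsto (fun h => (deriv G h - c₁) / h) (nhdsWithin 0 (Set.Ioi 0)) (nhds c₂) ∧
      (0 < c₁ ∨ 0 < c₂)
  CG_pos : 0 < CG
  growth : ∀ x y : ℝ, 0 < x → x < y → G y / G x ≤ CG * (y / x) ^ 2

/-- `u` is a nonnegative (measurable) random variable with cumulative distribution function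
`t ↦ 1 - exp (-G t)` on `[0,∞)`. -/
def HasExpGCDF {Ω : Type} [MeasurableSpace Ω] (μ : Measure Ω) (G : ℝ → ℝ) (u : Ω → ℝ) : Prop :=
  Measurable u ∧ (∀ ω, 0 ≤ u ω) ∧
    ∀ t : ℝ, 0 ≤ t → μ {ω | u ω ≤ t} = ENNReal.ofReal (1 - Real.exp (-(G t)))


lemma auerbach_aux {n d : ℕ} (V : Submodule ℝ (Fin n → ℝ)) (hV : Module.finrank ℝ V = d)
    (B : Set (Fin n → ℝ)) (hB : ∀ y ∈ B, ∀ i, |y i| ≤ 1)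
    (hs : ∀ y : Fin n → ℝ, ∃ ε > (0:ℝ), ε • y ∈ B) :
    ∃ v : Fin d → (Fin n → ℝ), (∀ j, v j ∈ B) ∧
      ∀ y ∈ V, y ∈ B → ∃ c : Fin d → ℝ, (∀ j, |c j| ≤ 2) ∧ y = ∑ j, c j • v j := by
  classical
  let b : Module.Basis (Fin d) ℝ V := Module.finBasisOfFinrankEq ℝ V hV
  let S : Set ℝ := {r | ∃ v : Fin d → V, (∀ j, (v j : Fin n → ℝ) ∈ B) ∧ r = |b.det v|}
  have hcoord : ∃ K : ℝ, ∀ y : V, (y : Fin n → ℝ) ∈ B → ∀ i, |b.repr y i| ≤ K := by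
    let L : V →L[ℝ] (Fin d → ℝ) := LinearMap.toContinuousLinearMap (b.equivFun : V →ₗ[ℝ] (Fin d → ℝ))
    refine ⟨‖L‖ * 1, fun y hy i => ?_⟩
    have h1 : ‖y‖ ≤ 1 := by
      have : ‖(y : Fin n → ℝ)‖ ≤ 1 := by
        rw [pi_norm_le_iff_of_nonneg zero_le_one]
        intro i; exact hB _ hy i
      simpa using this
    have h2 : ‖L y‖ ≤ ‖L‖ * 1 := (L.le_opNorm y).trans (by gcongr)
    have h3 := (norm_le_pi_norm (L y) i).trans h2
    simpa [L] using h3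
  obtain ⟨K, hK⟩ := hcoord
  have hbdd : BddAbove S := by
    refine ⟨(Fintype.card (Fin d)).factorial • K ^ (Fintype.card (Fin d)), ?_⟩
    rintro r ⟨v, hv, rfl⟩
    rw [Module.Basis.det_apply]
    refine Matrix.det_le (A := b.toMatrix v) (abv := AbsoluteValue.abs) (x := K) ?_
    intro i j
    exact hK (v j) (hv j) i
  choose ε hε hεB using hs
  have hpos : ∃ r ∈ S, 0 < r := by
    refine ⟨_, ⟨fun j => ε (b j) • b j, fun j => hεB (b j), rfl⟩, ?_⟩
    rw [abs_pos]
    have := b.det.map_smul_univ (fun j => ε (b j)) b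
    rw [this, Module.Basis.det_self]
    simp only [smul_eq_mul, mul_one]
    exact Finset.prod_ne_zero_iff.2 fun j _ => (hε _).ne'
  obtain ⟨r0, hr0S, hr0⟩ := hpos
  have hsup : 0 < sSup S := hr0.trans_le (le_csSup hbdd hr0S)
  obtain ⟨r, ⟨v, hvB, rfl⟩, hr⟩ := exists_lt_of_lt_csSup ⟨r0, hr0S⟩ (half_lt_self hsup)
  have hdet : 0 < |b.det v| := (half_pos hsup).trans hr
  have hbasis := (b.is_basis_iff_det (v := v)).2 (isUnit_iff_ne_zero.2 (abs_pos.1 hdet))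
  refine ⟨fun j => v j, hvB, fun y hyV hyB => ?_⟩
  let y' : V := ⟨y, hyV⟩
  let bv := Module.Basis.mk hbasis.1 hbasis.2.ge
  refine ⟨fun j => bv.repr y' j, fun j => ?_, ?_⟩
  · have h1 := b.det_smul_mk_coord_eq_det_update hbasis.1 hbasis.2.ge j
    have h2 := congrArg (fun f => f y') h1
    simp only [LinearMap.smul_apply, Module.Basis.coord_apply, smul_eq_mul, MultilinearMap.toLinearMap_apply] at h2
    have h3 : |b.det (Function.update v j y')| ≤ sSup S := by
      refine le_csSup hbdd ⟨_, fun k => ?_, rfl⟩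
      by_cases hk : k = j
      · subst hk; simpa [y'] using hyB
      · simpa [hk] using hvB k
    have h4 : |b.det v| * |bv.repr y' j| ≤ sSup S := by
      rw [← abs_mul]
      refine le_trans (le_of_eq ?_) h3
      exact congrArg abs h2
    by_contra hcon
    push Not at hcon
    nlinarith
  · have := bv.sum_repr y'
    have h := congrArg (fun z : V => (z : Fin n → ℝ)) this
    simp only [bv, Module.Basis.mk_apply] at h
    rw [show y = (y' : Fin n → ℝ) from rfl, ← h]
    simp [bv, y']

lemma PropertyP.scale {G : ℝ → ℝ} {CG : ℝ} (hG : PropertyP G CG) {x t : ℝ} (hx : 0 ≤ x)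
    (ht : 0 ≤ t) (ht1 : t ≤ 1) : G (t * x) ≤ t * G x := by
  have h := hG.convex.2 (show x ∈ Set.Ici (0:ℝ) from hx) (show (0:ℝ) ∈ Set.Ici (0:ℝ) by simp)
    ht (sub_nonneg.2 ht1) (by ring)
  simpa [hG.zero] using h

lemma PropertyP.lin_bound {G : ℝ → ℝ} {CG : ℝ} (hG : PropertyP G CG) :
    ∃ S ≥ (1:ℝ), ∀ x, 0 ≤ x → G x ≤ S * x := by
  obtain ⟨s, hs, h⟩ := hG.linear
  refine ⟨s + 1, by linarith, fun x hx => ?_⟩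
  rcases le_or_gt x 1 with h1 | h1
  · have := hG.scale zero_le_one hx h1
    rw [hG.one] at this
    simp only [mul_one] at this
    nlinarith
  · rw [h x h1]; nlinarith

lemma PropertyP.le_one {G : ℝ → ℝ} {CG : ℝ} (hG : PropertyP G CG) {x : ℝ} (hx : 0 ≤ x)
    (h : G x ≤ 1) : x ≤ 1 := by
  by_contra hc
  push Not at hc
  have h1 := hG.scale hx (t := x⁻¹) (by positivity) (inv_le_one_of_one_le₀ hc.le)
  rw [inv_mul_cancel₀ (by positivity), hG.one] at h1
  have h2 : x⁻¹ < 1 := inv_lt_one_of_one_lt₀ hc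
  have h3 : 0 < x⁻¹ := by positivity
  nlinarith

lemma PropertyP.main_bound {G : ℝ → ℝ} {CG : ℝ} (hG : PropertyP G CG) :
    ∃ p : ℕ, p ≠ 0 ∧ ∃ M ≥ (1:ℝ), (∀ t, 0 ≤ t → G t ≤ M * t ^ p) ∧
      ∀ a u, 0 ≤ a → 0 < u → G (a / u) ≤ M * G a * (1 + 1 / u ^ p) := by
  obtain ⟨S, hS1, hS⟩ := hG.lin_bound
  obtain ⟨δ, hδ, hdiff, c₁, c₂, hc₁, hc₂, hpos⟩ := hG.smooth
  have hlow : ∀ x, 0 ≤ x → c₁ * x ≤ G x := by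
    intro x hx
    rcases hx.eq_or_lt with rfl | hx
    · simp [hG.zero]
    have := hG.convex.le_slope_of_hasDerivWithinAt_Ioi (x := 0) (y := x) (by simp) hx.le hx
      (hc₁.mono Set.Ioi_subset_Ici_self)
    rw [slope_def_field, hG.zero, sub_zero, sub_zero, le_div_iff₀ hx] at this
    exact this
  by_cases h1 : 0 < c₁
  · refine ⟨1, one_ne_zero, S + S / c₁, ?_, ?_, ?_⟩
    · have : 0 < S / c₁ := by positivity
      linarith
    · intro t ht
      have : 0 < S / c₁ := by positivity
      have := hS t ht
      rw [pow_one]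
      nlinarith
    · intro a u ha hu
      have h2 := hS (a / u) (by positivity)
      have h3 : S * (a / u) ≤ S / c₁ * G a * (1 / u) := by
        have := hlow a ha
        calc S * (a / u) = S / c₁ * (c₁ * a) * (1 / u) := by field_simp
          _ ≤ _ := by gcongr
      have h4 := hG.nonneg a
      have h5 : S / c₁ * G a * (1 / u) ≤ (S + S / c₁) * G a * (1 + 1 / u ^ 1) := by
        rw [pow_one]
        have : 0 < 1 / u := by positivity
        gcongr <;> linarith
      linarith
  · have hc₂pos : 0 < c₂ := hpos.resolve_left h1
    have hc₁0 : 0 ≤ c₁ := by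
      have h := (hasDerivWithinAt_iff_tendsto_slope' (s := Set.Ioi (0:ℝ)) (by simp)).1
        (hc₁.mono Set.Ioi_subset_Ici_self)
      refine ge_of_tendsto h ?_
      filter_upwards [self_mem_nhdsWithin] with t ht
      rw [slope_def_field, hG.zero, sub_zero, sub_zero]
      exact div_nonneg (hG.nonneg t) (le_of_lt ht)
    have hc₁z : c₁ = 0 := le_antisymm (not_lt.1 h1) hc₁0
    subst hc₁z
    simp only [sub_zero] at hc₂
    have hGpos : ∀ x, 0 < x → 0 < G x := by
      intro x hx
      by_contra hcon
      have hx0 : G x = 0 := le_antisymm (not_lt.1 hcon) (hG.nonneg x)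
      have hz : ∀ y ∈ Set.Ioo 0 x, G y = 0 := fun y hy =>
        le_antisymm (hx0 ▸ hG.mono hy.1.le hx.le hy.2.le) (hG.nonneg y)
      have hev : ∀ᶠ h in nhdsWithin (0:ℝ) (Set.Ioi 0), deriv G h / h = 0 := by
        filter_upwards [Ioo_mem_nhdsGT hx] with h hh
        have : G =ᶠ[nhds h] fun _ => 0 := by
          filter_upwards [Ioo_mem_nhds hh.1 hh.2] with y hy using hz y hy
        rw [this.deriv_eq]; simp
      have := tendsto_nhds_unique (hc₂.congr' hev) tendsto_const_nhds
      exact hc₂pos.ne' this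
    have hev : ∀ᶠ h in nhdsWithin (0:ℝ) (Set.Ioi 0), deriv G h / h < c₂ + 1 :=
      hc₂.eventually (gt_mem_nhds (by linarith))
    obtain ⟨ε, hε, hεs⟩ := (mem_nhdsGT_iff_exists_Ioo_subset).1
      (hev.and (Ioo_mem_nhdsGT hδ))
    replace hε : 0 < ε := hε
    have hquad : ∀ t, 0 ≤ t → G t ≤ (c₂ + 1 + S / ε) * t ^ 2 := by
      intro t ht
      have hSε : 0 < S / ε := by positivity
      rcases ht.eq_or_lt with rfl | ht
      · simp [hG.zero]
      rcases lt_or_ge t ε with h | h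
      · obtain ⟨h2, h3⟩ := hεs ⟨ht, h⟩
        have h4 := hG.convex.slope_le_deriv (x := 0) (y := t) (by simp) ht.le ht (hdiff t h3).1
        rw [slope_def_field, hG.zero, sub_zero, sub_zero, div_le_iff₀ ht] at h4
        rw [div_lt_iff₀ ht] at h2
        have h5 : deriv G t * t ≤ (c₂ + 1) * t * t := by gcongr
        nlinarith [sq_nonneg t]
      · have h2 := hS t ht.le
        have h3 : S * t ≤ S / ε * t ^ 2 := by
          calc S * t = S / ε * (ε * t) := by field_simp
            _ ≤ S / ε * (t * t) := by gcongr
            _ = _ := by ring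
        nlinarith [sq_nonneg t]
    have hCG := hG.CG_pos
    have hSε : 0 < S / ε := by positivity
    refine ⟨2, two_ne_zero, c₂ + 1 + S / ε + CG, by linarith, ?_, ?_⟩
    · intro t ht
      have := hquad t ht
      nlinarith [sq_nonneg t]
    · intro a u ha hu
      rcases ha.eq_or_lt with rfl | ha
      · simp [hG.zero]
      have h0 := hGpos a ha
      have hM : CG * G a * (1 / u ^ 2) ≤ (c₂ + 1 + S / ε + CG) * G a * (1 + 1 / u ^ 2) := by
        have : 0 < 1 / u ^ 2 := by positivity
        gcongr <;> linarith
      have hM' : 1 * G a * 1 ≤ (c₂ + 1 + S / ε + CG) * G a * (1 + 1 / u ^ 2) := by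
        have : 0 < 1 / u ^ 2 := by positivity
        gcongr <;> linarith
      rcases le_or_gt 1 u with h | h
      · have : G (a / u) ≤ G a := hG.mono (show 0 ≤ a / u by positivity) ha.le (div_le_self ha.le h)
        linarith
      · have hlt : a < a / u := by rw [lt_div_iff₀ hu]; nlinarith
        have := hG.growth a (a / u) ha hlt
        rw [div_le_iff₀ h0] at this
        refine this.trans (le_trans (le_of_eq ?_) hM)
        field_simp

lemma dyadic_bound (L : ℕ) (v : ℝ) (hv : (1 / 2 : ℝ) ^ L < v) :
    1 / v ≤ 1 + ∑ k ∈ Finset.range L, (2:ℝ) ^ (k + 1) *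
      Set.indicator {x : ℝ | x ≤ (1 / 2 : ℝ) ^ k} (fun _ => (1:ℝ)) v := by
  have hv0 : 0 < v := lt_trans (by positivity) hv
  have hnn : ∀ k : ℕ, 0 ≤ (2:ℝ) ^ (k + 1) *
      Set.indicator {x : ℝ | x ≤ (1 / 2 : ℝ) ^ k} (fun _ => (1:ℝ)) v := fun k =>
    mul_nonneg (by positivity) (Set.indicator_nonneg (fun _ _ => zero_le_one) _)
  induction L with
  | zero =>
    simp only [pow_zero] at hv
    simp only [Finset.range_zero, Finset.sum_empty, add_zero]
    rw [div_le_one hv0]; exact hv.le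
  | succ L ih =>
    rw [Finset.sum_range_succ]
    rcases lt_or_ge ((1 / 2 : ℝ) ^ L) v with h | h
    · have := ih h
      linarith [hnn L]
    · have h1 : (0:ℝ) ≤ ∑ k ∈ Finset.range L, (2:ℝ) ^ (k + 1) *
        Set.indicator {x : ℝ | x ≤ (1 / 2 : ℝ) ^ k} (fun _ => (1:ℝ)) v :=
        Finset.sum_nonneg fun k _ => hnn k
      rw [Set.indicator_of_mem (show v ∈ {x : ℝ | x ≤ (1 / 2 : ℝ) ^ L} from h)]
      have h2 : 1 / v ≤ 2 ^ (L + 1) := by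
        rw [div_le_iff₀ hv0]
        rw [one_div, inv_pow] at hv
        have : (2:ℝ) ^ (L + 1) * ((2:ℝ) ^ (L + 1))⁻¹ = 1 := mul_inv_cancel₀ (by positivity)
        rw [← this]
        gcongr
      linarith

lemma prob_aux {Ω : Type} [MeasurableSpace Ω] (μ : Measure Ω) [IsProbabilityMeasure μ] {n : ℕ}
    (v : Fin n → Ω → ℝ) (hmeas : ∀ i, Measurable (v i)) (M : ℝ) (hM1 : 1 ≤ M)
    (hM : ∀ i t, 0 ≤ t → μ {ω | v i ω ≤ t} ≤ ENNReal.ofReal (M * t))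
    (b : Fin n → ℝ) (hb : ∀ i, 0 ≤ b i) (hb1 : ∑ i, b i ≤ 1) (L : ℕ)
    (hL : 200 * M * n ≤ 2 ^ L) :
    ENNReal.ofReal 0.99 ≤ μ {ω | (∀ i, 0 < v i ω) ∧
      ∑ i, b i * (1 + 1 / v i ω) ≤ 200 * (2 + 2 * M * L)} := by
  set T : ℝ := 2 + 2 * M * L with hT
  have hTpos : 0 < T := by positivity
  let A : Fin n → ℕ → Set Ω := fun i k => {ω | v i ω ≤ (1 / 2 : ℝ) ^ k}
  have hA : ∀ i k, MeasurableSet (A i k) := fun i k => hmeas i measurableSet_Iic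
  have hAμ : ∀ i k, μ.real (A i k) ≤ M * (1 / 2 : ℝ) ^ k := by
    intro i k
    exact ENNReal.toReal_le_of_le_ofReal (by positivity) (hM i _ (by positivity))
  let f : Fin n → Ω → ℝ := fun i ω => 2 + ∑ k ∈ Finset.range L, (2:ℝ) ^ (k + 1) *
      (A i k).indicator (fun _ => (1:ℝ)) ω
  have hind : ∀ i k, Integrable ((A i k).indicator (fun _ => (1:ℝ))) μ := fun i k =>
    (integrable_const (1:ℝ)).indicator (hA i k)
  have hfsum : ∀ i, Integrable (fun ω => ∑ k ∈ Finset.range L, (2:ℝ) ^ (k + 1) *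
      (A i k).indicator (fun _ => (1:ℝ)) ω) μ := fun i =>
    integrable_finsetSum _ fun k _ => (hind i k).const_mul _
  have hfint : ∀ i, Integrable (f i) μ := fun i => (integrable_const _).add (hfsum i)
  have hf0 : ∀ i ω, 0 ≤ f i ω := fun i ω => add_nonneg zero_le_two
    (Finset.sum_nonneg fun k _ => mul_nonneg (by positivity)
      (Set.indicator_nonneg (fun _ _ => zero_le_one) _))
  have hfE : ∀ i, ∫ ω, f i ω ∂μ ≤ T := by
    intro i
    have h1 : ∫ ω, f i ω ∂μ = 2 + ∑ k ∈ Finset.range L, (2:ℝ) ^ (k + 1) * μ.real (A i k) := by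
      simp only [f]
      rw [integral_add (integrable_const _) (hfsum i),
        integral_finsetSum _ fun k _ => (hind i k).const_mul _]
      congr 1
      · simp
      · refine Finset.sum_congr rfl fun k _ => ?_
        rw [integral_const_mul, integral_indicator_const _ (hA i k)]
        simp
    rw [h1, hT]
    have h2 : ∑ k ∈ Finset.range L, (2:ℝ) ^ (k + 1) * μ.real (A i k) ≤
        ∑ k ∈ Finset.range L, 2 * M := by
      refine Finset.sum_le_sum fun k _ => ?_
      calc (2:ℝ) ^ (k + 1) * μ.real (A i k) ≤ 2 ^ (k + 1) * (M * (1 / 2 : ℝ) ^ k) := by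
            gcongr; exact hAμ i k
        _ = 2 * M * (2 ^ k * (1 / 2 : ℝ) ^ k) := by ring
        _ = 2 * M := by rw [← mul_pow]; norm_num
    rw [Finset.sum_const, Finset.card_range, nsmul_eq_mul] at h2
    linarith
  let Φ : Ω → ℝ := fun ω => ∑ i, b i * f i ω
  have hΦint : Integrable Φ μ := integrable_finsetSum _ fun i _ => (hfint i).const_mul _
  have hΦE : ∫ ω, Φ ω ∂μ ≤ T := by
    simp only [Φ]
    rw [integral_finsetSum _ fun i _ => (hfint i).const_mul _]
    calc ∑ i, ∫ ω, b i * f i ω ∂μ ≤ ∑ i, b i * T := by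
          refine Finset.sum_le_sum fun i _ => ?_
          rw [integral_const_mul]
          exact mul_le_mul_of_nonneg_left (hfE i) (hb i)
      _ = (∑ i, b i) * T := by rw [Finset.sum_mul]
      _ ≤ 1 * T := by gcongr
      _ = T := one_mul T
  have hmark : μ.real {ω | 200 * T ≤ Φ ω} ≤ 1 / 200 := by
    have h := mul_meas_ge_le_integral_of_nonneg (μ := μ) (f := Φ)
      (ae_of_all _ fun ω => Finset.sum_nonneg fun i _ => mul_nonneg (hb i) (hf0 i ω))
      hΦint (200 * T)
    have h' := h.trans hΦE
    have : T * (200 * μ.real {ω | 200 * T ≤ Φ ω}) ≤ T * 1 := by linarith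
    have := le_of_mul_le_mul_left this hTpos
    linarith
  have hunion : μ.real (⋃ i, A i L) ≤ 1 / 200 := by
    have h1 : μ.real (⋃ i, A i L) ≤ ∑ i, μ.real (A i L) := measureReal_iUnion_fintype_le _
    have h2 : ∑ i, μ.real (A i L) ≤ ∑ i : Fin n, M * (1 / 2 : ℝ) ^ L :=
      Finset.sum_le_sum fun i _ => hAμ i L
    rw [Finset.sum_const, Finset.card_univ, Fintype.card_fin, nsmul_eq_mul] at h2
    have h3 : (n:ℝ) * (M * (1 / 2 : ℝ) ^ L) = (200 * M * n) / 2 ^ L / 200 := by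
      rw [one_div, inv_pow]; field_simp
    have h4 : (200 * M * n) / 2 ^ L ≤ (1:ℝ) := (div_le_one (by positivity)).2 hL
    linarith
  let bad : Set Ω := {ω | 200 * T ≤ Φ ω} ∪ ⋃ i, A i L
  have hbad : μ.real bad ≤ 1 / 100 := (measureReal_union_le _ _).trans (by linarith)
  have hΦmeas : Measurable Φ := by
    refine Finset.measurable_sum _ fun i _ => Measurable.const_mul ?_ _
    refine Measurable.const_add (Finset.measurable_sum _ fun k _ => Measurable.const_mul ?_ _) _
    exact measurable_const.indicator (hA i k)
  have hbadm : MeasurableSet bad :=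
    (measurableSet_le measurable_const hΦmeas).union (MeasurableSet.iUnion fun i => hA i L)
  have hgood : ENNReal.ofReal 0.99 ≤ μ badᶜ := by
    rw [← ofReal_measureReal (μ := μ)]
    refine ENNReal.ofReal_le_ofReal ?_
    rw [probReal_compl_eq_one_sub hbadm]
    norm_num at hbad ⊢
    linarith
  refine hgood.trans (measure_mono ?_)
  intro ω hω
  simp only [bad, Set.mem_compl_iff, Set.mem_union, not_or, Set.mem_iUnion, not_exists,
    Set.mem_setOf_eq, not_le, A] at hω
  obtain ⟨h1, h2⟩ := hω
  refine ⟨fun i => lt_trans (by positivity) (h2 i), le_trans ?_ h1.le⟩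
  refine Finset.sum_le_sum fun i _ => mul_le_mul_of_nonneg_left ?_ (hb i)
  have h3 := dyadic_bound L (v i ω) (h2 i)
  have h4 : f i ω = 2 + ∑ k ∈ Finset.range L, (2:ℝ) ^ (k + 1) *
      Set.indicator {x : ℝ | x ≤ (1 / 2 : ℝ) ^ k} (fun _ => (1:ℝ)) (v i ω) := rfl
  rw [h4]
  linarith

lemma orlicz_det {G : ℝ → ℝ} {CG : ℝ} (hG : PropertyP G CG) {n d : ℕ} (hd : 0 < d)
    (w : Fin d → Fin n → ℝ) (u : Fin n → ℝ) (hu : ∀ i, 0 < u i) (K : ℝ) (hK : 0 < K)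
    (hsum : ∑ i, (1 / d : ℝ) * ∑ j, G (|w j i| / (u i * K)) ≤ 1)
    (y : Fin n → ℝ)
    (hy : ∀ α > (0:ℝ), ∑ i, G (|y i| / α) ≤ 1 → ∃ c : Fin d → ℝ, (∀ j, |c j| ≤ 2) ∧
      α⁻¹ • y = ∑ j, c j • w j) :
    OrliczNorm G (fun i => y i / u i) ≤ 2 * d * K * OrliczNorm G y := by
  have hd' : (0:ℝ) < d := by exact_mod_cast hd
  have hne : {α : ℝ | 0 < α ∧ ∑ i, G (|y i| / α) ≤ 1}.Nonempty := by
    obtain ⟨S, hS1, hS⟩ := hG.lin_bound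
    refine ⟨S * ∑ i, |y i| + 1, by positivity, ?_⟩
    calc ∑ i, G (|y i| / (S * ∑ i, |y i| + 1)) ≤ ∑ i, S * (|y i| / (S * ∑ i, |y i| + 1)) :=
          Finset.sum_le_sum fun i _ => hS _ (by positivity)
      _ = (S * ∑ i, |y i|) / (S * ∑ i, |y i| + 1) := by
          rw [← Finset.mul_sum, ← Finset.sum_div]; ring
      _ ≤ 1 := by rw [div_le_one (by positivity)]; linarith
  rw [← div_le_iff₀' (by positivity)]
  unfold OrliczNorm
  refine le_csInf hne ?_
  rintro α ⟨hα, hαs⟩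
  rw [div_le_iff₀' (by positivity)]
  refine csInf_le ⟨0, fun β hβ => hβ.1.le⟩ ⟨by positivity, le_trans ?_ hsum⟩
  obtain ⟨c, hc, hcy⟩ := hy α hα hαs
  refine Finset.sum_le_sum fun i _ => ?_
  have hyi : y i / α = ∑ j, c j * w j i := by
    have := congrFun hcy i
    simp only [Pi.smul_apply, smul_eq_mul, Finset.sum_apply] at this
    rw [← this]; ring
  have habs : |y i| / α ≤ 2 * ∑ j, |w j i| := by
    have h0 : |y i| / α = |y i / α| := by rw [abs_div, abs_of_pos hα]
    rw [h0, hyi, Finset.mul_sum]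
    refine (Finset.abs_sum_le_sum_abs _ _).trans (Finset.sum_le_sum fun j _ => ?_)
    rw [abs_mul]
    gcongr
    exact hc j
  have hui := hu i
  have hle : |y i / u i| / (2 * d * K * α) ≤ ∑ j, (1 / d : ℝ) • (|w j i| / (u i * K)) := by
    calc |y i / u i| / (2 * d * K * α) = (|y i| / α) * (1 / (2 * d * K * u i)) := by
          rw [abs_div, abs_of_pos (hu i)]; field_simp
      _ ≤ (2 * ∑ j, |w j i|) * (1 / (2 * d * K * u i)) := by gcongr
      _ = ∑ j, (1 / d : ℝ) • (|w j i| / (u i * K)) := by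
          rw [Finset.mul_sum, Finset.sum_mul]
          refine Finset.sum_congr rfl fun j _ => ?_
          simp only [smul_eq_mul]
          field_simp
  have hnn : ∀ j, 0 ≤ |w j i| / (u i * K) := fun j => by positivity
  have hconv := hG.convex.map_sum_le (t := Finset.univ) (w := fun _ : Fin d => (1 / d : ℝ))
    (p := fun j => |w j i| / (u i * K)) (fun _ _ => by positivity)
    (by simp [hd'.ne']) (fun j _ => hnn j)
  have hmono := hG.mono (show 0 ≤ |y i / u i| / (2 * d * K * α) by positivity)
    (show 0 ≤ ∑ j, (1 / d : ℝ) • (|w j i| / (u i * K)) from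
      Finset.sum_nonneg fun j _ => smul_nonneg (by positivity) (hnn j)) hle
  refine (hmono.trans hconv).trans (le_of_eq ?_)
  simp only [smul_eq_mul, Finset.mul_sum]

/-- Theorem 10 (dilation bound for a subspace): for a rank-`d` matrix `A` and a random
diagonal matrix `D` whose diagonal entries have marginal CDF `1 - exp (-G t)`, with
probability at least `0.99`, for all `x` simultaneously,
`‖D⁻¹Ax‖_G ≤ C αG d² log n · ‖Ax‖_G`. -/
theorem orlicz_dilation_subspace (G : ℝ → ℝ) (CG : ℝ) (hG : PropertyP G CG) :
    ∃ C ≥ (1:ℝ), ∃ αG ≥ (1:ℝ),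
      ∀ (n m d : ℕ), 2 ≤ n → 1 ≤ m → d ≤ n →
      ∀ A : Matrix (Fin n) (Fin m) ℝ, A.rank = d →
      ∀ (Ω : Type) [MeasurableSpace Ω] (μ : Measure Ω), IsProbabilityMeasure μ →
      ∀ u : Fin n → Ω → ℝ, (∀ i, HasExpGCDF μ G (u i)) →
        ENNReal.ofReal 0.99 ≤ μ {ω | ∀ x : Fin m → ℝ,
          OrliczNorm G (fun i => A.mulVec x i / u i ω) ≤
            C * αG * (d : ℝ) ^ 2 * Real.log n * OrliczNorm G (A.mulVec x)} := by
  obtain ⟨p, hp, M, hM1, hMt, hMa⟩ := hG.main_bound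
  obtain ⟨l0, hl0⟩ := pow_unbounded_of_one_lt (200 * M) (one_lt_two : (1:ℝ) < 2)
  set T0 : ℝ := 4 + 4 * M * (l0 + 2) with hT0
  have hT04 : 4 ≤ T0 := by
    have : 0 ≤ 4 * M * (l0 + 2) := by positivity
    linarith
  refine ⟨400 * M * T0, by nlinarith, 1, le_rfl, ?_⟩
  intro n m d hn hm hdn A hA Ω _ μ hμ u hu
  have := hμ
  have hn0 : n ≠ 0 := by omega
  have hlog2 : (1:ℝ) / 2 ≤ Real.log 2 := by linarith [Real.log_two_gt_d9]
  have hlogn : Real.log 2 ≤ Real.log n :=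
    Real.log_le_log (by norm_num) (by exact_mod_cast hn)
  set L : ℕ := l0 + Nat.log 2 n + 1 with hL
  have hLpow : 200 * M * n ≤ (2:ℝ) ^ L := by
    have h1 : (n:ℝ) ≤ 2 ^ (Nat.log 2 n + 1) := by
      exact_mod_cast (Nat.lt_pow_succ_log_self one_lt_two n).le
    rw [hL, add_assoc, pow_add]
    gcongr
  have hLlog : (L:ℝ) ≤ 2 * (l0 + 2) * Real.log n := by
    have h1 : (Nat.log 2 n : ℝ) * Real.log 2 ≤ Real.log n := by
      rw [← Real.log_pow]
      refine Real.log_le_log (by positivity) ?_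
      exact_mod_cast Nat.pow_log_le_self 2 hn0
    have h2 : (Nat.log 2 n : ℝ) ≤ 2 * Real.log n := by
      have : (0:ℝ) ≤ Nat.log 2 n := Nat.cast_nonneg _
      nlinarith
    have h3 : (0:ℝ) ≤ l0 := Nat.cast_nonneg _
    rw [hL]; push_cast
    nlinarith
  have hT : 2 + 2 * M * L ≤ T0 * Real.log n := by
    have : 2 * M * L ≤ 2 * M * (2 * (l0 + 2) * Real.log n) := by gcongr
    rw [hT0]
    nlinarith
  rcases Nat.eq_zero_or_pos d with hd | hd
  · subst hd
    have hA0 : ∀ x, A.mulVec x = 0 := by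
      intro x
      have h1 : LinearMap.range A.mulVecLin = ⊥ := Submodule.finrank_eq_zero.1 hA
      have h2 : A.mulVecLin x ∈ LinearMap.range A.mulVecLin := ⟨x, rfl⟩
      rw [h1] at h2
      simpa using h2
    have h0 : OrliczNorm G (fun _ : Fin n => (0:ℝ)) = 0 := by
      unfold OrliczNorm
      have : {α : ℝ | 0 < α ∧ ∑ _i : Fin n, G (|(0:ℝ)| / α) ≤ 1} = Set.Ioi 0 := by
        ext α; simp [hG.zero]
      rw [this, csInf_Ioi]
    have huniv : {ω | ∀ x : Fin m → ℝ,
          OrliczNorm G (fun i => A.mulVec x i / u i ω) ≤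
            400 * M * T0 * 1 * ((0:ℕ) : ℝ) ^ 2 * Real.log n * OrliczNorm G (A.mulVec x)} = Set.univ := by
      ext ω
      simp only [hA0, Pi.zero_apply, zero_div, h0]
      simp
    rw [huniv, measure_univ, ← ENNReal.ofReal_one]
    exact ENNReal.ofReal_le_ofReal (by norm_num)
  have hd1 : (1:ℝ) ≤ d := by exact_mod_cast hd
  obtain ⟨w, hwB, hw⟩ := auerbach_aux (LinearMap.range A.mulVecLin) (d := d) hA
    {y | ∑ i, G |y i| ≤ 1}
    (fun y hy i => hG.le_one (abs_nonneg _)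
      ((Finset.single_le_sum (f := fun i => G |y i|) (fun i _ => hG.nonneg _)
        (Finset.mem_univ i)).trans hy))
    (by
      intro y
      obtain ⟨S, hS1, hS⟩ := hG.lin_bound
      refine ⟨(S * ∑ i, |y i| + 1)⁻¹, by positivity, ?_⟩
      have hpos : 0 < S * ∑ i, |y i| + 1 := by positivity
      calc ∑ i, G |((S * ∑ i, |y i| + 1)⁻¹ • y) i|
          ≤ ∑ i, S * |((S * ∑ i, |y i| + 1)⁻¹ • y) i| :=
            Finset.sum_le_sum fun i _ => hS _ (abs_nonneg _)
        _ = (S * ∑ i, |y i|) / (S * ∑ i, |y i| + 1) := by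
            simp only [Pi.smul_apply, smul_eq_mul, abs_mul, abs_inv, abs_of_pos hpos]
            rw [← Finset.mul_sum, ← Finset.mul_sum]; ring
        _ ≤ 1 := by rw [div_le_one hpos]; linarith)
  set b : Fin n → ℝ := fun i => (1 / d : ℝ) * ∑ j, G |w j i| with hb
  have hb0 : ∀ i, 0 ≤ b i := fun i =>
    mul_nonneg (by positivity) (Finset.sum_nonneg fun j _ => hG.nonneg _)
  have hb1 : ∑ i, b i ≤ 1 := by
    rw [hb, ← Finset.mul_sum, Finset.sum_comm]
    have : ∑ j, ∑ i, G |w j i| ≤ ∑ _j : Fin d, (1:ℝ) := Finset.sum_le_sum fun j _ => hwB j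
    simp only [Finset.sum_const, Finset.card_univ, Fintype.card_fin, nsmul_eq_mul, mul_one] at this
    calc (1 / d : ℝ) * ∑ j, ∑ i, G |w j i| ≤ (1 / d : ℝ) * d := by gcongr
      _ = 1 := by field_simp
  have hprob := prob_aux μ (fun i ω => u i ω ^ p) (fun i => (hu i).1.pow_const p) M hM1
    (by
      intro i t ht
      set r : ℝ := t ^ ((p:ℝ)⁻¹) with hr
      have hr0 : 0 ≤ r := Real.rpow_nonneg ht _
      have hrp : r ^ p = t := Real.rpow_inv_natCast_pow ht hp
      have hsub : {ω | u i ω ^ p ≤ t} ⊆ {ω | u i ω ≤ r} := by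
        intro ω hω
        have hω' : u i ω ^ p ≤ r ^ p := by rw [hrp]; exact hω
        exact (pow_le_pow_iff_left₀ ((hu i).2.1 ω) hr0 hp).1 hω'
      refine (measure_mono hsub).trans ?_
      rw [(hu i).2.2 r hr0]
      refine ENNReal.ofReal_le_ofReal ?_
      have h1 := Real.add_one_le_exp (-(G r))
      have h2 := hMt r hr0
      rw [hrp] at h2
      linarith) b hb0 hb1 L hLpow
  refine hprob.trans (measure_mono ?_)
  rintro ω ⟨hpos, hsum⟩ x
  have hupos : ∀ i, 0 < u i ω := by
    intro i
    refine lt_of_le_of_ne ((hu i).2.1 ω) fun h => ?_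
    have := hpos i
    simp [← h, hp] at this
  set K : ℝ := 200 * M * T0 * Real.log n * d with hK
  have hK0 : 200 * M * (T0 * Real.log n) ≤ K := by
    have : 0 ≤ 200 * M * T0 * Real.log n := by positivity
    rw [hK]; nlinarith
  have hK1 : 1 ≤ K := by
    have h2 : 2 ≤ T0 * Real.log n := by nlinarith
    nlinarith
  have hmain := orlicz_det hG hd w (fun i => u i ω) hupos K (by linarith) (by
    calc ∑ i, (1 / d : ℝ) * ∑ j, G (|w j i| / (u i ω * K))
        ≤ ∑ i, (1 / d : ℝ) * ∑ j, K⁻¹ * (M * G |w j i| * (1 + 1 / u i ω ^ p)) := by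
          gcongr with i _ j _
          have h1 := hG.scale (x := |w j i| / u i ω) (t := K⁻¹)
            (div_nonneg (abs_nonneg _) (hupos i).le) (by positivity) (inv_le_one_of_one_le₀ hK1)
          have h2 := hMa |w j i| (u i ω) (abs_nonneg _) (hupos i)
          have h3 : K⁻¹ * (|w j i| / u i ω) = |w j i| / (u i ω * K) := by
            rw [div_mul_eq_div_div]; ring
          rw [h3] at h1
          exact h1.trans (by gcongr)
      _ = K⁻¹ * M * ∑ i, b i * (1 + 1 / u i ω ^ p) := by
          rw [Finset.mul_sum]
          refine Finset.sum_congr rfl fun i _ => ?_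
          simp only [hb, ← Finset.mul_sum, ← Finset.sum_mul]
          ring
      _ ≤ K⁻¹ * M * (200 * (T0 * Real.log n)) := by
          gcongr
          exact hsum.trans (by gcongr)
      _ = (200 * M * (T0 * Real.log n)) / K := by ring
      _ ≤ 1 := by rw [div_le_one (by linarith)]; exact hK0) (A.mulVec x) (by
    intro α hα hs
    refine hw _ (Submodule.smul_mem _ _ ⟨x, rfl⟩) ?_
    refine le_trans (le_of_eq ?_) hs
    refine Finset.sum_congr rfl fun i _ => ?_
    simp only [Pi.smul_apply, smul_eq_mul, abs_mul, abs_inv, abs_of_pos hα]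
    congr 1; ring)
  refine hmain.trans (le_of_eq ?_)
  rw [hK]; ring
end
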